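/- arXiv:2009.03295 — 2 statements merged into one kernel-verified Lean document; each statement's English description precedes it below -/
import Mathlib

section
/- For any infinite digraph D, the map ω ↦ f_ω is a bijection between the set of ends of D and the set of vertex-directions of D. -/
variable {V : Type*}

/-- Reachability from `a` to `b` by a directed walk staying inside the vertex set `S`. -/
def ReachIn (D : V → V → Prop) (S : Set V) (a b : V) : Prop :=
  a ∈ S ∧ b ∈ S ∧ Relation.ReflTransGen (fun x y => y ∈ S ∧ D x y) a b

/-- `C` is a strong component of the subdigraph of `D` induced on `S`. -/
def IsSCCIn (D : V → V → Prop) (S : Set V) (C : Set V) : Prop :=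
  ∃ a ∈ S, C = {b | ReachIn D S a b ∧ ReachIn D S b a}

/-- A directed ray in `D`. -/
def IsRay (D : V → V → Prop) (R : ℕ → V) : Prop :=
  Function.Injective R ∧ ∀ n, D (R n) (R (n + 1))

/-- A reverse directed ray in `D`. -/
def IsRevRay (D : V → V → Prop) (R : ℕ → V) : Prop :=
  Function.Injective R ∧ ∀ n, D (R (n + 1)) (R n)

/-- The ray `R` has a tail inside the vertex set `C`. -/
def HasTailIn (R : ℕ → V) (C : Set V) : Prop :=
  ∃ n, ∀ m, n ≤ m → R m ∈ C

/-- A solid ray: for every finite `X` it has a tail in some strong component of `D − X`. -/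
def Solid (D : V → V → Prop) (R : ℕ → V) : Prop :=
  IsRay D R ∧ ∀ X : Finset V, ∃ C, IsSCCIn D ((↑X : Set V)ᶜ) C ∧ HasTailIn R C

/-- Two solid rays are end-equivalent: for every finite `X` they have tails in the same
strong component of `D − X`. -/
def EndEquiv (D : V → V → Prop) (R R' : ℕ → V) : Prop :=
  ∀ X : Finset V, ∃ C, IsSCCIn D ((↑X : Set V)ᶜ) C ∧ HasTailIn R C ∧ HasTailIn R' C

/-- `Ω` is an end of `D`: the class of solid rays equivalent to some solid ray. -/
def IsEnd (D : V → V → Prop) (Ω : Set (ℕ → V)) : Prop :=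
  ∃ R, Solid D R ∧ Ω = {R' | Solid D R' ∧ EndEquiv D R R'}

/-- A (nonempty) directed path, recorded as its list of vertices. -/
def IsPathList (D : V → V → Prop) (l : List V) : Prop :=
  l ≠ [] ∧ l.Nodup ∧ l.Chain' D

/-- Infinitely many pairwise disjoint `A`–`B` paths in `D` (each meeting `A` precisely in its
first vertex and `B` precisely in its last vertex). -/
def DisjointPathsFrom (D : V → V → Prop) (A B : Set V) : Prop :=
  ∃ P : ℕ → List V,
    (∀ k, IsPathList D (P k)) ∧
    (∀ j k, j ≠ k → ∀ x ∈ P j, x ∉ P k) ∧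
    (∀ k, ∃ a, (P k).head? = some a ∧ a ∈ A) ∧
    (∀ k, ∃ b, (P k).getLast? = some b ∧ b ∈ B) ∧
    (∀ k, ∀ x ∈ (P k).tail, x ∉ A) ∧
    (∀ k, ∀ x ∈ (P k).dropLast, x ∉ B)

/-- A necklace in `D`: an inflated symmetric ray with finite branch sets (beads), given by its
beads together with the connecting (subdividing) paths in both directions. -/
structure Necklace (D : V → V → Prop) where
  bead : ℕ → Set V
  fwd : ℕ → List V
  bwd : ℕ → List V
  bead_fin : ∀ n, (bead n).Finite
  bead_nonempty : ∀ n, (bead n).Nonempty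
  bead_disj : ∀ m n, m ≠ n → Disjoint (bead m) (bead n)
  bead_strong : ∀ n, ∀ a ∈ bead n, ∀ b ∈ bead n, ReachIn D (bead n) a b
  fwd_path : ∀ n, IsPathList D (fwd n)
  bwd_path : ∀ n, IsPathList D (bwd n)
  fwd_head : ∀ n a, (fwd n).head? = some a → a ∈ bead n
  fwd_last : ∀ n b, (fwd n).getLast? = some b → b ∈ bead (n + 1)
  bwd_head : ∀ n a, (bwd n).head? = some a → a ∈ bead (n + 1)
  bwd_last : ∀ n b, (bwd n).getLast? = some b → b ∈ bead n
  fwd_inner : ∀ n, ∀ x ∈ (fwd n).tail.dropLast, ∀ m, x ∉ bead m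
  bwd_inner : ∀ n, ∀ x ∈ (bwd n).tail.dropLast, ∀ m, x ∉ bead m
  fwd_fwd_disj : ∀ m n, m ≠ n → ∀ x ∈ (fwd m).tail.dropLast, x ∉ (fwd n).tail.dropLast
  bwd_bwd_disj : ∀ m n, m ≠ n → ∀ x ∈ (bwd m).tail.dropLast, x ∉ (bwd n).tail.dropLast
  fwd_bwd_disj : ∀ m n, ∀ x ∈ (fwd m).tail.dropLast, x ∉ (bwd n).tail.dropLast

/-- The vertex set of a necklace. -/
def Necklace.verts {D : V → V → Prop} (N : Necklace D) : Set V :=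
  (⋃ n, N.bead n) ∪ {x | ∃ n, x ∈ N.fwd n ∨ x ∈ N.bwd n}

/-- A necklace is attached to `𝒰` if infinitely many of its beads meet every set in `𝒰`. -/
def Necklace.AttachedTo {D : V → V → Prop} (N : Necklace D) (𝒰 : Finset (Set V)) : Prop :=
  {n | ∀ U ∈ 𝒰, (N.bead n ∩ U).Nonempty}.Infinite

/-- A necklace represents the end of the solid ray `R`: for every finite `X`, all but finitely
many beads lie in the strong component of `D − X` in which `R` has a tail. -/
def NecklaceRepresents {D : V → V → Prop} (N : Necklace D) (R : ℕ → V) : Prop :=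
  ∀ X : Finset V, ∃ C, IsSCCIn D ((↑X : Set V)ᶜ) C ∧ HasTailIn R C ∧
    ∃ n₀, ∀ n, n₀ ≤ n → N.bead n ⊆ C

/-- `URankLE D 𝒰 S α`: the subdigraph of `D` induced on `S` has `𝒰`-rank at most `α`. -/
inductive URankLE (D : V → V → Prop) (𝒰 : Finset (Set V)) : Set V → Ordinal → Prop
  | base (S : Set V) (α : Ordinal) (U : Set V) (hU : U ∈ 𝒰) (h : (U ∩ S).Finite) :
      URankLE D 𝒰 S α
  | step (S : Set V) (α : Ordinal) (X : Finset V) (r : Set V → Ordinal)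
      (hr : ∀ C, IsSCCIn D (S \ ↑X) C → r C < α)
      (h : ∀ C, IsSCCIn D (S \ ↑X) C → URankLE D 𝒰 C (r C)) :
      URankLE D 𝒰 S α

/-- `D` (induced on `S`) has `𝒰`-rank exactly `α`. -/
def HasURank (D : V → V → Prop) (𝒰 : Finset (Set V)) (S : Set V) (α : Ordinal) : Prop :=
  URankLE D 𝒰 S α ∧ ∀ β < α, ¬ URankLE D 𝒰 S β

/-- A vertex-direction of `D`. -/
def IsVertexDirection (D : V → V → Prop) (f : Finset V → Set V) : Prop :=
  (∀ X : Finset V, IsSCCIn D ((↑X : Set V)ᶜ) (f X)) ∧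
  ∀ X Y : Finset V, X ⊆ Y → f Y ⊆ f X

/-- A separation `(A,B)` of `D`: `A ∪ B = V(D)` and no edge from `B∖A` to `A∖B`. -/
def IsSep (D : V → V → Prop) (A B : Set V) : Prop :=
  A ∪ B = Set.univ ∧ ∀ a ∈ B \ A, ∀ b ∈ A \ B, ¬ D a b

/-- A finite order separation `(A,B)` points towards the vertex-direction `f`. -/
def PointsTowards (D : V → V → Prop) (f : Finset V → Set V) (A B : Set V)
    (h : (A ∩ B).Finite) : Prop :=
  f h.toFinset ⊆ B \ A

/-- A finite order separation `(A,B)` points away from the vertex-direction `f`. -/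
def PointsAway (D : V → V → Prop) (f : Finset V → Set V) (A B : Set V)
    (h : (A ∩ B).Finite) : Prop :=
  f h.toFinset ⊆ A \ B

/-- The vertex `v` dominates the vertex-direction `f`. -/
def DomDir (D : V → V → Prop) (v : V) (f : Finset V → Set V) : Prop :=
  ∀ A B, IsSep D A B → ∀ h : (A ∩ B).Finite, PointsAway D f A B h → v ∈ A

/-- An infinite `v`–`B` fan: infinitely many `v`–`B` paths meeting pairwise precisely in `v`. -/
def Fan (D : V → V → Prop) (v : V) (B : Set V) : Prop :=
  ∃ P : ℕ → List V,
    (∀ k, IsPathList D (P k)) ∧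
    (∀ k, (P k).head? = some v) ∧
    (∀ k, 2 ≤ (P k).length) ∧
    (∀ k, ∃ b, (P k).getLast? = some b ∧ b ∈ B) ∧
    (∀ k, ∀ x ∈ (P k).dropLast, x ∉ B) ∧
    (∀ j k, j ≠ k → ∀ x ∈ (P j).tail, x ∉ (P k).tail)

/-- Limit edge between the ends of the solid rays `R` and `R'`. -/
def LimitEdgeEE (D : V → V → Prop) (R R' : ℕ → V) : Prop :=
  ∀ (X : Finset V) C C', IsSCCIn D ((↑X : Set V)ᶜ) C → HasTailIn R C →
    IsSCCIn D ((↑X : Set V)ᶜ) C' → HasTailIn R' C' → C ≠ C' →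
    ∃ a ∈ C, ∃ b ∈ C', D a b

/-- Limit edge from the vertex `v` to the end of the solid ray `R`. -/
def LimitEdgeVE (D : V → V → Prop) (v : V) (R : ℕ → V) : Prop :=
  ∀ (X : Finset V) C, IsSCCIn D ((↑X : Set V)ᶜ) C → HasTailIn R C → v ∉ C →
    ∃ b ∈ C, D v b

/-- Limit edge from the end of the solid ray `R` to the vertex `v`. -/
def LimitEdgeEV (D : V → V → Prop) (R : ℕ → V) (v : V) : Prop :=
  ∀ (X : Finset V) C, IsSCCIn D ((↑X : Set V)ᶜ) C → HasTailIn R C → v ∉ C →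
    ∃ a ∈ C, D a v

/-- A subdivided infinite out-star in `D` with centre `c`, given by its paths. -/
def IsStar (D : V → V → Prop) (c : V) (P : ℕ → List V) : Prop :=
  (∀ k, IsPathList D (P k)) ∧ (∀ k, (P k).head? = some c) ∧
  (∀ k, 2 ≤ (P k).length) ∧
  (∀ j k, j ≠ k → ∀ x ∈ (P j).tail, x ∉ (P k).tail)

/-- A directed comb in `D` with spine `R`, given by its (pairwise disjoint) paths each meeting
`R` precisely in its first vertex. -/
def IsComb (D : V → V → Prop) (R : ℕ → V) (P : ℕ → List V) : Prop :=
  IsRay D R ∧ (∀ k, IsPathList D (P k)) ∧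
  (∀ k, ∃ n, (P k).head? = some (R n)) ∧
  (∀ k, ∀ x ∈ (P k).tail, ∀ n, x ≠ R n) ∧
  (∀ j k, j ≠ k → ∀ x ∈ P j, x ∉ P k)

/-- A star in `D` whose `k`-th leaf is `a k`. -/
def StarAttachedWith (D : V → V → Prop) (a : ℕ → V) : Prop :=
  ∃ c P, IsStar D c P ∧ ∀ k, (P k).getLast? = some (a k)

/-- A comb in `D` whose `k`-th tooth is `a k`. -/
def CombAttachedWith (D : V → V → Prop) (a : ℕ → V) : Prop :=
  ∃ R P, IsComb D R P ∧ ∀ k, (P k).getLast? = some (a k)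

/-- `a` and `b` are consecutive entries of the list `l`. -/
def AdjInList (l : List V) (a b : V) : Prop :=
  ∃ l₁ l₂, l = l₁ ++ a :: b :: l₂

/-- The edge relation of (a subdigraph of `D` forming) the necklace `N`: all `D`-edges inside a
bead together with the edges of the connecting paths. -/
def Necklace.edges {D : V → V → Prop} (N : Necklace D) (a b : V) : Prop :=
  D a b ∧ ((∃ n, a ∈ N.bead n ∧ b ∈ N.bead n) ∨
    (∃ n, AdjInList (N.fwd n) a b ∨ AdjInList (N.bwd n) a b))

/-- A generalized ray: a directed ray (`true`) or a reverse directed ray (`false`). -/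
def IsGenRay (D : V → V → Prop) : Bool × (ℕ → V) → Prop
  | (true, R) => IsRay D R
  | (false, R) => IsRevRay D R

/-- Pre-end equivalence of generalized rays: infinitely many disjoint paths in both
directions. -/
def PreEquiv (D : V → V → Prop) (Q Q' : Bool × (ℕ → V)) : Prop :=
  DisjointPathsFrom D (Set.range Q.2) (Set.range Q'.2) ∧
  DisjointPathsFrom D (Set.range Q'.2) (Set.range Q.2)

/-- The pre-end `γ` includes the end represented by the solid ray `R`. -/
def IncludesEnd (D : V → V → Prop) (γ : Set (Bool × (ℕ → V))) (R : ℕ → V) : Prop :=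
  Solid D R ∧ ∀ R', Solid D R' → EndEquiv D R R' → (true, R') ∈ γ

/-- The set of edges of `D` from `A` to `B`. -/
def EdgesBetween (D : V → V → Prop) (A B : Set V) : Set (V × V) :=
  {e | D e.1 e.2 ∧ e.1 ∈ A ∧ e.2 ∈ B}

/-- A bundle of `D − X`. -/
def IsBundle (D : V → V → Prop) (X : Finset V) (E : Set (V × V)) : Prop :=
  E.Nonempty ∧
  ((∃ C C', IsSCCIn D ((↑X : Set V)ᶜ) C ∧ IsSCCIn D ((↑X : Set V)ᶜ) C' ∧ C ≠ C' ∧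
      E = EdgesBetween D C C') ∨
   (∃ v ∈ X, ∃ C, IsSCCIn D ((↑X : Set V)ᶜ) C ∧
      (E = EdgesBetween D {v} C ∨ E = EdgesBetween D C {v})))

/-- Compatibility `f(X) ⊇ f(Y)` between values of a direction (a strong component is regarded
as containing a bundle if it contains all its edges). -/
def DirCompat : Set V ⊕ Set (V × V) → Set V ⊕ Set (V × V) → Prop
  | Sum.inl C, Sum.inl C' => C' ⊆ C
  | Sum.inl C, Sum.inr E' => ∀ e ∈ E', e.1 ∈ C ∧ e.2 ∈ C
  | Sum.inr _, Sum.inl _ => False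
  | Sum.inr E, Sum.inr E' => E' ⊆ E

/-- A direction of `D`: maps each finite `X` to a strong component or a bundle of `D − X`,
compatibly. -/
def IsDirection (D : V → V → Prop) (f : Finset V → Set V ⊕ Set (V × V)) : Prop :=
  (∀ X : Finset V, (∃ C, IsSCCIn D ((↑X : Set V)ᶜ) C ∧ f X = Sum.inl C) ∨
    (∃ E, IsBundle D X E ∧ f X = Sum.inr E)) ∧
  ∀ X Y : Finset V, X ⊆ Y → DirCompat (f X) (f Y)

/-- An edge-direction: a direction whose value is a bundle for some finite `X`. -/
def IsEdgeDirection (D : V → V → Prop) (f : Finset V → Set V ⊕ Set (V × V)) : Prop :=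
  IsDirection D f ∧ ∃ (X : Finset V) (E : Set (V × V)), f X = Sum.inr E

/-- The three kinds of (potential) limit edges: end–end, vertex–end, end–vertex.
Ends are given as sets of (solid) rays. -/
inductive LimitEdgeObj (V : Type*) where
  | ee (Ω₁ Ω₂ : Set (ℕ → V))
  | ve (v : V) (Ω : Set (ℕ → V))
  | ev (Ω : Set (ℕ → V)) (v : V)

/-- `l` is a limit edge of `D`. -/
def IsLimitEdge (D : V → V → Prop) : LimitEdgeObj V → Prop
  | LimitEdgeObj.ee Ω₁ Ω₂ => IsEnd D Ω₁ ∧ IsEnd D Ω₂ ∧ Ω₁ ≠ Ω₂ ∧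
      ∀ R ∈ Ω₁, ∀ R' ∈ Ω₂, LimitEdgeEE D R R'
  | LimitEdgeObj.ve v Ω => IsEnd D Ω ∧ ∀ R ∈ Ω, LimitEdgeVE D v R
  | LimitEdgeObj.ev Ω v => IsEnd D Ω ∧ ∀ R ∈ Ω, LimitEdgeEV D R v

/-- `f` agrees with the map `f_λ` for the end–end limit edge `Ω₁Ω₂`. -/
def AgreesEE (D : V → V → Prop) (Ω₁ Ω₂ : Set (ℕ → V))
    (f : Finset V → Set V ⊕ Set (V × V)) : Prop :=
  ∀ (X : Finset V), ∀ R ∈ Ω₁, ∀ R' ∈ Ω₂, ∀ C C',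
    IsSCCIn D ((↑X : Set V)ᶜ) C → HasTailIn R C →
    IsSCCIn D ((↑X : Set V)ᶜ) C' → HasTailIn R' C' →
    (C = C' → f X = Sum.inl C) ∧ (C ≠ C' → f X = Sum.inr (EdgesBetween D C C'))

/-- `f` agrees with the map `f_λ` for the vertex–end limit edge `vΩ`. -/
def AgreesVE (D : V → V → Prop) (v : V) (Ω : Set (ℕ → V))
    (f : Finset V → Set V ⊕ Set (V × V)) : Prop :=
  ∀ (X : Finset V), ∀ R ∈ Ω, ∀ C, IsSCCIn D ((↑X : Set V)ᶜ) C → HasTailIn R C →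
    (v ∈ C → f X = Sum.inl C) ∧
    (v ∈ (↑X : Set V) → f X = Sum.inr (EdgesBetween D {v} C)) ∧
    (∀ C', IsSCCIn D ((↑X : Set V)ᶜ) C' → v ∈ C' → C' ≠ C →
      f X = Sum.inr (EdgesBetween D C' C))

/-- `f` agrees with the map `f_λ` for the end–vertex limit edge `Ωv`. -/
def AgreesEV (D : V → V → Prop) (Ω : Set (ℕ → V)) (v : V)
    (f : Finset V → Set V ⊕ Set (V × V)) : Prop :=
  ∀ (X : Finset V), ∀ R ∈ Ω, ∀ C, IsSCCIn D ((↑X : Set V)ᶜ) C → HasTailIn R C →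
    (v ∈ C → f X = Sum.inl C) ∧
    (v ∈ (↑X : Set V) → f X = Sum.inr (EdgesBetween D C {v})) ∧
    (∀ C', IsSCCIn D ((↑X : Set V)ᶜ) C' → v ∈ C' → C' ≠ C →
      f X = Sum.inr (EdgesBetween D C C'))

/-- `f` agrees with `f_λ` for the limit edge `l`. -/
def Agrees (D : V → V → Prop) : LimitEdgeObj V → (Finset V → Set V ⊕ Set (V × V)) → Prop
  | LimitEdgeObj.ee Ω₁ Ω₂, f => AgreesEE D Ω₁ Ω₂ f
  | LimitEdgeObj.ve v Ω, f => AgreesVE D v Ω f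
  | LimitEdgeObj.ev Ω v, f => AgreesEV D Ω v f

/-! ### Auxiliary lemmas -/

/-- `B` induces a strongly connected subdigraph. -/
def StrongSet (D : V → V → Prop) (B : Set V) : Prop :=
  ∀ a ∈ B, ∀ b ∈ B, ReachIn D B a b

theorem ReachIn.mono' {D : V → V → Prop} {S T : Set V} (h : S ⊆ T) {a b : V}
    (hr : ReachIn D S a b) : ReachIn D T a b :=
  ⟨h hr.1, h hr.2.1, hr.2.2.lift id (fun _ _ hxy => ⟨h hxy.1, hxy.2⟩)⟩

theorem ReachIn.trans' {D : V → V → Prop} {S : Set V} {a b c : V}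
    (h : ReachIn D S a b) (h' : ReachIn D S b c) : ReachIn D S a c :=
  ⟨h.1, h'.2.1, h.2.2.trans h'.2.2⟩

theorem IsSCCIn.sub {D : V → V → Prop} {S C : Set V} (h : IsSCCIn D S C) : C ⊆ S := by
  obtain ⟨a, ha, rfl⟩ := h
  intro x hx
  exact hx.1.2.1

theorem IsSCCIn.nonempty' {D : V → V → Prop} {S C : Set V} (h : IsSCCIn D S C) :
    C.Nonempty := by
  obtain ⟨a, ha, rfl⟩ := h
  exact ⟨a, ⟨ha, ha, .refl⟩, ⟨ha, ha, .refl⟩⟩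

theorem IsSCCIn.mem_of {D : V → V → Prop} {S C : Set V} (h : IsSCCIn D S C) {a b x : V}
    (ha : a ∈ C) (hb : b ∈ C) (h1 : ReachIn D S a x) (h2 : ReachIn D S x b) : x ∈ C := by
  obtain ⟨c, hc, rfl⟩ := h
  exact ⟨ha.1.trans' h1, h2.trans' hb.2⟩

theorem IsSCCIn.reach {D : V → V → Prop} {S C : Set V} (h : IsSCCIn D S C) {a b : V}
    (ha : a ∈ C) (hb : b ∈ C) : ReachIn D S a b := by
  obtain ⟨c, hc, rfl⟩ := h
  exact ha.2.trans' hb.1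

theorem IsSCCIn.strong {D : V → V → Prop} {S C : Set V} (h : IsSCCIn D S C) :
    StrongSet D C := by
  intro a ha b hb
  refine ⟨ha, hb, ?_⟩
  have hr := (h.reach ha hb).2.2
  induction hr using Relation.ReflTransGen.head_induction_on with
  | refl => exact .refl
  | head hxy hyb ih =>
    rename_i x y
    have hy : y ∈ C := h.mem_of ha hb
      ⟨h.sub ha, hxy.1, Relation.ReflTransGen.single hxy⟩ ⟨hxy.1, h.sub hb, hyb⟩
    exact Relation.ReflTransGen.head ⟨hy, hxy.2⟩ (ih hy)

theorem IsSCCIn.absorb {D : V → V → Prop} {S C : Set V} (h : IsSCCIn D S C) {B : Set V}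
    (hB : StrongSet D B) (hBS : B ⊆ S) {x : V} (hxB : x ∈ B) (hxC : x ∈ C) : B ⊆ C :=
  fun y hy => h.mem_of hxC hxC ((hB x hxB y hy).mono' hBS) ((hB y hy x hxB).mono' hBS)

theorem IsSCCIn.eq_of {D : V → V → Prop} {S C C' : Set V} (h : IsSCCIn D S C)
    (h' : IsSCCIn D S C') {x : V} (hx : x ∈ C) (hx' : x ∈ C') : C = C' :=
  Set.Subset.antisymm (h'.absorb h.strong h.sub hx hx') (h.absorb h'.strong h'.sub hx' hx)

/-- A finite walk inside `C`. -/
theorem ReachIn.exists_finset {D : V → V → Prop} {C : Set V} {a b : V}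
    (h : ReachIn D C a b) : ∃ P : Finset V, (P : Set V) ⊆ C ∧ ReachIn D P a b ∧
      ∀ x ∈ P, ReachIn D P a x ∧ ReachIn D P x b := by
  classical
  obtain ⟨ha, hb, hr⟩ := h
  clear hb
  induction hr with
  | refl =>
    have : ReachIn D (({a} : Finset V) : Set V) a a := ⟨by simp, by simp, .refl⟩
    refine ⟨{a}, by simpa using ha, this, ?_⟩
    intro x hx
    obtain rfl : x = a := by simpa using hx
    exact ⟨this, this⟩
  | tail hab hbc ih =>
    rename_i y z
    obtain ⟨P, hPC, hP, hx⟩ := ih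
    have hsub : (P : Set V) ⊆ ((insert z P : Finset V) : Set V) := by simp
    have hz : z ∈ ((insert z P : Finset V) : Set V) := by simp
    have hyz : ReachIn D ((insert z P : Finset V) : Set V) y z :=
      ⟨hsub hP.2.1, hz, Relation.ReflTransGen.single ⟨hz, hbc.2⟩⟩
    have haz := (hP.mono' hsub).trans' hyz
    refine ⟨insert z P, ?_, haz, ?_⟩
    · intro x hx
      rcases Finset.mem_insert.1 (Finset.mem_coe.1 hx) with rfl | hx
      · exact hbc.1
      · exact hPC hx
    · intro x hxm
      rcases Finset.mem_insert.1 hxm with rfl | hxm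
      · exact ⟨haz, hz, hz, .refl⟩
      · exact ⟨(hx x hxm).1.mono' hsub, ((hx x hxm).2.mono' hsub).trans' hyz⟩

theorem strong_of_hub {D : V → V → Prop} {B : Set V} (c : V)
    (h : ∀ x ∈ B, ReachIn D B c x ∧ ReachIn D B x c) : StrongSet D B :=
  fun a ha b hb => (h a ha).2.trans' (h b hb).1

theorem StrongSet.exists_finset {D : V → V → Prop} {C : Set V} (hC : StrongSet D C)
    {c : V} (hc : c ∈ C) (F : Finset V) (hF : (F : Set V) ⊆ C) :
    ∃ B : Finset V, c ∈ B ∧ F ⊆ B ∧ (B : Set V) ⊆ C ∧ StrongSet D (B : Set V) := by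
  classical
  induction F using Finset.induction_on with
  | empty =>
    refine ⟨{c}, by simp, by simp, by simpa using hc, strong_of_hub c ?_⟩
    intro x hx
    obtain rfl : x = c := by simpa using hx
    exact ⟨⟨hx, hx, .refl⟩, ⟨hx, hx, .refl⟩⟩
  | insert a F ha ih =>
    obtain ⟨B, hcB, hFB, hBC, hB⟩ := ih (fun x hx => hF (by simp [Finset.mem_coe.1 hx]))
    have haC : a ∈ C := hF (by simp)
    obtain ⟨P, hPC, hP, hPx⟩ := (hC c hc a haC).exists_finset
    obtain ⟨Q, hQC, hQ, hQx⟩ := (hC a haC c hc).exists_finset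
    have s1 : (B : Set V) ⊆ ((B ∪ P ∪ Q : Finset V) : Set V) := by
      intro x hx; simp [Finset.mem_coe.1 hx]
    have s2 : (P : Set V) ⊆ ((B ∪ P ∪ Q : Finset V) : Set V) := by
      intro x hx; simp [Finset.mem_coe.1 hx]
    have s3 : (Q : Set V) ⊆ ((B ∪ P ∪ Q : Finset V) : Set V) := by
      intro x hx; simp [Finset.mem_coe.1 hx]
    refine ⟨B ∪ P ∪ Q, s1 hcB, ?_, ?_, strong_of_hub c ?_⟩
    · intro x hx
      rcases Finset.mem_insert.1 hx with rfl | hx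
      · exact s2 hP.2.1
      · exact s1 (hFB hx)
    · intro x hx
      rcases Finset.mem_union.1 (Finset.mem_coe.1 hx) with hx | hx
      · rcases Finset.mem_union.1 hx with hx | hx
        · exact hBC hx
        · exact hPC hx
      · exact hQC hx
    · intro x hx
      rcases Finset.mem_union.1 (Finset.mem_coe.1 hx) with hx | hx
      · rcases Finset.mem_union.1 hx with hx | hx
        · exact ⟨(hB c hcB x hx).mono' s1, (hB x hx c hcB).mono' s1⟩
        · exact ⟨(hPx x hx).1.mono' s2, ((hPx x hx).2.mono' s2).trans' (hQ.mono' s3)⟩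
      · exact ⟨(hP.mono' s2).trans' ((hQx x hx).1.mono' s3), (hQx x hx).2.mono' s3⟩

/-- A finite walk as a lazy function. -/
theorem ReachIn.exists_fun {D : V → V → Prop} {W : Set V} {a b : V} (h : ReachIn D W a b) :
    ∃ (L : ℕ) (g : ℕ → V), g 0 = a ∧ g L = b ∧ (∀ i, g i ∈ W) ∧
      ∀ i, D (g i) (g (i + 1)) ∨ g i = g (i + 1) := by
  obtain ⟨ha, hb, hr⟩ := h
  induction hr using Relation.ReflTransGen.head_induction_on with
  | refl => exact ⟨0, fun _ => b, rfl, rfl, fun _ => hb, fun _ => Or.inr rfl⟩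
  | head hxy hyb ih =>
    rename_i x y
    obtain ⟨L, g, h0, hL, hW, hD⟩ := ih hxy.1
    refine ⟨L + 1, fun i => Nat.casesOn i x g, rfl, hL, ?_, ?_⟩
    · intro i
      cases i with
      | zero => exact ha
      | succ i => exact hW i
    · intro i
      cases i with
      | zero => left; show D x (g 0); rw [h0]; exact hxy.2
      | succ i => exact hD i

/-- Concatenating finite walks to a lazy infinite walk. -/
theorem exists_lazy_walk {D : V → V → Prop} (p : ℕ → V) (W : ℕ → Set V)
    (h : ∀ n, ReachIn D (W n) (p n) (p (n + 1))) :
    ∃ w : ℕ → V, (∀ k, D (w k) (w (k + 1)) ∨ w k = w (k + 1)) ∧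
      ∀ N, ∃ K, ∀ k, K ≤ k → ∃ n, N ≤ n ∧ w k ∈ W n := by
  classical
  choose L g h0 hL hW hD using fun n => (h n).exists_fun
  let nx : ℕ × ℕ → ℕ × ℕ := fun s => if s.2 = L s.1 then (s.1 + 1, 0) else (s.1, s.2 + 1)
  let st : ℕ → ℕ × ℕ := fun k => nx^[k] (0, 0)
  have hst : ∀ k, st (k + 1) = nx (st k) := fun k => Function.iterate_succ_apply' nx k _
  have hle : ∀ k, (st k).2 ≤ L (st k).1 := by
    intro k
    induction k with
    | zero => exact Nat.zero_le _
    | succ k ih =>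
      rw [hst]
      simp only [nx]
      split_ifs with hc
      · exact Nat.zero_le _
      · show (st k).2 + 1 ≤ L (st k).1
        omega
  have hmono : Monotone fun k => (st k).1 := by
    refine monotone_nat_of_le_succ fun k => ?_
    rw [hst]
    simp only [nx]
    split_ifs <;> simp
  have hadv : ∀ d k, L (st k).1 - (st k).2 = d → ∃ k', (st k').1 = (st k).1 + 1 := by
    intro d
    induction d with
    | zero =>
      intro k hk
      have := hle k
      refine ⟨k + 1, ?_⟩
      rw [hst]
      simp only [nx]
      rw [if_pos (by omega)]
    | succ d ih =>
      intro k hk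
      have e : st (k + 1) = ((st k).1, (st k).2 + 1) := by
        rw [hst]
        simp only [nx]
        rw [if_neg (by omega)]
      obtain ⟨k', hk'⟩ := ih (k + 1) (by rw [e]; simp only; omega)
      exact ⟨k', by rw [hk', e]⟩
  have hunb : ∀ N, ∃ k, (st k).1 = N := by
    intro N
    induction N with
    | zero => exact ⟨0, rfl⟩
    | succ N ih =>
      obtain ⟨k, hk⟩ := ih
      obtain ⟨k', hk'⟩ := hadv _ k rfl
      exact ⟨k', by rw [hk', hk]⟩
  refine ⟨fun k => g (st k).1 (st k).2, ?_, ?_⟩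
  · intro k
    show D _ (g (st (k + 1)).1 (st (k + 1)).2) ∨ _ = g (st (k + 1)).1 (st (k + 1)).2
    rw [hst]
    simp only [nx]
    split_ifs with hc
    · right
      show _ = g ((st k).1 + 1) 0
      rw [hc, hL, h0]
    · exact hD _ _
  · intro N
    obtain ⟨K, hK⟩ := hunb N
    refine ⟨K, fun k hk => ⟨(st k).1, ?_, hW _ _⟩⟩
    rw [← hK]
    exact hmono hk

/-- Extracting a ray from a lazy walk visiting every vertex finitely often. -/
theorem exists_ray_of_lazy {D : V → V → Prop} (w : ℕ → V)
    (hw : ∀ k, D (w k) (w (k + 1)) ∨ w k = w (k + 1))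
    (hfin : ∀ v, ∃ K, ∀ k, K ≤ k → w k ≠ v) :
    ∃ κ : ℕ → ℕ, StrictMono κ ∧ IsRay D (fun i => w (κ i)) := by
  classical
  have hlast : ∀ k, ∃ l, k ≤ l ∧ w l = w k ∧ ∀ m, l < m → w m ≠ w k := by
    intro k
    obtain ⟨K, hK⟩ := hfin (w k)
    have hkK : k ≤ K := by
      by_contra hc
      exact hK k (by omega) rfl
    refine ⟨Nat.findGreatest (fun l => w l = w k) K, Nat.le_findGreatest hkK rfl,
      Nat.findGreatest_spec (P := fun l => w l = w k) hkK rfl, ?_⟩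
    intro m hm hmk
    have hmK : m < K := by
      by_contra hc
      exact hK m (by omega) hmk
    exact Nat.findGreatest_is_greatest hm hmK.le hmk
  choose l hl1 hl2 hl3 using hlast
  let κ : ℕ → ℕ := fun i => Nat.rec (l 0) (fun _ k => l (k + 1)) i
  have hκ : ∀ i, κ (i + 1) = l (κ i + 1) := fun i => rfl
  have hgr : ∀ i m, κ i < m → w m ≠ w (κ i) := by
    intro i m hm
    cases i with
    | zero =>
      show w m ≠ w (l 0)
      rw [hl2]; exact hl3 0 m hm
    | succ i =>
      rw [hκ] at hm ⊢
      rw [hl2]; exact hl3 _ m hm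
  have hsm : StrictMono κ := strictMono_nat_of_lt_succ fun i => by
    have := hl1 (κ i + 1)
    rw [hκ]; omega
  refine ⟨κ, hsm, ?_, ?_⟩
  · intro i j hij
    rcases lt_trichotomy i j with h | h | h
    · exact absurd hij.symm (hgr i _ (hsm h))
    · exact h
    · exact absurd hij (hgr j _ (hsm h))
  · intro i
    show D (w (κ i)) (w (κ (i + 1)))
    rw [hκ, hl2]
    rcases hw (κ i) with h | h
    · exact h
    · exact absurd h.symm (hgr i _ (Nat.lt_succ_self _))

section direction

variable {D : V → V → Prop} {f : Finset V → Set V}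

theorem IsVertexDirection.sub_of_disj (hf : IsVertexDirection D f) {X Y : Finset V}
    (h : ∀ x ∈ X, x ∉ f Y) : f Y ⊆ f X := by
  classical
  obtain ⟨z, hz⟩ := (hf.1 (X ∪ Y)).nonempty'
  exact (hf.1 X).absorb (hf.1 Y).strong (fun y hy hyX => h y hyX hy)
    (hf.2 _ _ Finset.subset_union_right hz) (hf.2 _ _ Finset.subset_union_left hz)

/-- A bead concentrated at the direction `f`. -/
def GoodBead (D : V → V → Prop) (f : Finset V → Set V) (B : Finset V) : Prop :=
  B.Nonempty ∧ StrongSet D (B : Set V) ∧ ∀ X : Finset V, Disjoint B X → (B : Set V) ⊆ f X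

theorem segments_of_beads (hf : IsVertexDirection D f)
    (h : ∀ X : Finset V, ∃ B, GoodBead D f B ∧ Disjoint B X) :
    ∃ (p : ℕ → V) (W : ℕ → Set V), (∀ n, ReachIn D (W n) (p n) (p (n + 1))) ∧
      ∀ X : Finset V, ∃ N, ∀ n, N ≤ n → W n ⊆ f X := by
  classical
  choose β hβ hβd using h
  -- a state is a pair (used vertices, current bead)
  let Good : Finset V × Finset V → Prop := fun s => GoodBead D f s.2 ∧ Disjoint s.2 s.1
  have hstep : ∀ s : {s // Good s}, ∃ (t : {s // Good s}) (P : Finset V),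
      (∀ x ∈ P, x ∉ s.1.1) ∧ s.1.1 ⊆ t.1.1 ∧ Disjoint t.1.2 s.1.2 ∧
      s.1.2 ⊆ t.1.1 ∧ P ⊆ t.1.1 ∪ t.1.2 ∧
      ReachIn D (P : Set V) s.2.1.1.choose t.2.1.1.choose ∧
      (∀ x ∈ P, ReachIn D (P : Set V) s.2.1.1.choose x ∧
        ReachIn D (P : Set V) x t.2.1.1.choose) := by
    rintro ⟨⟨U, B⟩, hB, hBU⟩
    have hg := hβ (U ∪ B)
    have hd := hβd (U ∪ B)
    rw [Finset.disjoint_union_right] at hd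
    have hb := hB.1.choose_spec
    have hb' := hg.1.choose_spec
    have hr : ReachIn D (f U) hB.1.choose hg.1.choose :=
      (hf.1 U).strong _ (hB.2.2 U hBU hb) _ (hg.2.2 U hd.1 hb')
    obtain ⟨P, hPf, hP, hPx⟩ := hr.exists_finset
    refine ⟨⟨((U ∪ B ∪ P) \ β (U ∪ B), β (U ∪ B)), hg, Finset.disjoint_sdiff⟩, P, ?_, ?_, ?_,
      ?_, ?_, hP, hPx⟩
    · intro x hx
      exact (hf.1 U).sub (hPf hx)
    · intro x hx
      have hx : x ∈ U := hx
      exact Finset.mem_sdiff.2 ⟨by simp [hx], fun hc => Finset.disjoint_left.1 hd.1 hc hx⟩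
    · exact hd.2
    · intro x hx
      have hx : x ∈ B := hx
      exact Finset.mem_sdiff.2 ⟨by simp [hx], fun hc => Finset.disjoint_left.1 hd.2 hc hx⟩
    · intro x hx
      by_cases hc : x ∈ β (U ∪ B)
      · exact Finset.mem_union_right _ hc
      · exact Finset.mem_union_left _ (Finset.mem_sdiff.2 ⟨by simp [hx], hc⟩)
  choose nx Pn h1 h2 h3 h4 h5 h6 h7 using hstep
  let st : ℕ → {s // Good s} := fun k =>
    nx^[k] ⟨(∅, β ∅), hβ ∅, Finset.disjoint_empty_right _⟩
  have hst : ∀ k, st (k + 1) = nx (st k) := fun k => Function.iterate_succ_apply' nx k _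
  have hUmono : Monotone fun k => (st k).1.1 :=
    monotone_nat_of_le_succ fun k => by rw [hst]; exact h2 _
  have hBU : ∀ k, (st k).1.2 ⊆ (st (k + 1)).1.1 := fun k => by rw [hst]; exact h4 _
  have hPU : ∀ k, Pn (st k) ⊆ (st (k + 2)).1.1 := by
    intro k x hx
    have := h5 (st k) hx
    rw [← hst] at this
    rcases Finset.mem_union.1 this with hh | hh
    · exact hUmono (Nat.le_succ (k + 1)) hh
    · exact hBU (k + 1) hh
  -- every vertex is avoided eventually
  have hvP : ∀ v, ∃ N, ∀ n, N ≤ n → v ∉ Pn (st n) := by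
    intro v
    by_cases hv : ∃ k, v ∈ Pn (st k)
    · obtain ⟨k, hk⟩ := hv
      exact ⟨k + 2, fun n hn hc => h1 _ v hc (hUmono hn (hPU k hk))⟩
    · exact ⟨0, fun n _ hc => hv ⟨n, hc⟩⟩
  have hvB : ∀ v, ∃ N, ∀ n, N ≤ n → v ∉ (st n).1.2 := by
    intro v
    by_cases hv : ∃ k, v ∈ (st k).1.2
    · obtain ⟨k, hk⟩ := hv
      exact ⟨k + 1, fun n hn hc =>
        Finset.disjoint_left.1 (st n).2.2 hc (hUmono hn (hBU k hk))⟩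
    · exact ⟨0, fun n _ hc => hv ⟨n, hc⟩⟩
  choose NP hNP using hvP
  choose NB hNB using hvB
  refine ⟨fun n => (st n).2.1.1.choose, fun n => (Pn (st n) : Set V), ?_, ?_⟩
  · intro n
    have := h6 (st n)
    simp only [← hst] at this
    exact this
  · intro X
    refine ⟨X.sup NP + X.sup NB, fun n hn => ?_⟩
    have hX : ∀ x ∈ X, NP x ≤ n ∧ NB x ≤ n := by
      intro x hx
      have e1 := Finset.le_sup (f := NP) hx
      have e2 := Finset.le_sup (f := NB) hx
      omega
    have hd : Disjoint (st n).1.2 X := Finset.disjoint_left.2 fun x hx hxX =>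
      hNB x n (hX x hxX).2 hx
    have hd' : Disjoint (st (n + 1)).1.2 X := Finset.disjoint_left.2 fun x hx hxX =>
      hNB x (n + 1) ((hX x hxX).2.trans (Nat.le_succ n)) hx
    have hsub : (Pn (st n) : Set V) ⊆ ((X : Set V)ᶜ) := fun x hx hxX =>
      hNP x n (hX x hxX).1 hx
    have m1 : (st n).2.1.1.choose ∈ f X := (st n).2.1.2.2 X hd (st n).2.1.1.choose_spec
    have m2 : (st (n + 1)).2.1.1.choose ∈ f X :=
      (st (n + 1)).2.1.2.2 X hd' (st (n + 1)).2.1.1.choose_spec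
    simp only [hst] at m2
    intro x hx
    exact (hf.1 X).mem_of m1 m2 ((h7 (st n) x hx).1.mono' hsub) ((h7 (st n) x hx).2.mono' hsub)

theorem segments_of_not_beads (hf : IsVertexDirection D f)
    (h : ∃ X : Finset V, ∀ B, GoodBead D f B → ¬ Disjoint B X) :
    ∃ (p : ℕ → V) (W : ℕ → Set V), (∀ n, ReachIn D (W n) (p n) (p (n + 1))) ∧
      ∀ X : Finset V, ∃ N, ∀ n, N ≤ n → W n ⊆ f X := by
  classical
  obtain ⟨X₀, hX₀⟩ := h
  obtain ⟨b, hb⟩ := (hf.1 X₀).nonempty'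
  let Ok : Finset V → Prop := fun B => b ∈ B ∧ (B : Set V) ⊆ f X₀ ∧ StrongSet D (B : Set V)
  have hstep : ∀ B : {B // Ok B}, ∃ (S : Finset V) (B' : {B // Ok B}), X₀ ⊆ S ∧ Disjoint B.1 S ∧
      (∀ x ∈ B.1, x ∉ f S) ∧ B.1 ⊆ B'.1 ∧ ∀ x ∈ S, x ∈ f X₀ → x ∈ B'.1 := by
    rintro ⟨B, hbB, hBf, hB⟩
    have hd : Disjoint B X₀ := Finset.disjoint_left.2 fun x hx hx0 => (hf.1 X₀).sub (hBf hx) hx0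
    have hng : ¬ GoodBead D f B := fun hg => hX₀ B hg hd
    have : ∃ X : Finset V, Disjoint B X ∧ ¬ (B : Set V) ⊆ f X := by
      by_contra hc
      push Not at hc
      exact hng ⟨⟨b, hbB⟩, hB, hc⟩
    obtain ⟨X, hBX, hnX⟩ := this
    have hdS : Disjoint B (X ∪ X₀) := Finset.disjoint_union_right.2 ⟨hBX, hd⟩
    obtain ⟨B', hb', hFB', hB'f, hB'⟩ := (hf.1 X₀).strong.exists_finset hb
      (B ∪ (X ∪ X₀).filter (· ∈ f X₀)) (by
        intro x hx
        rcases Finset.mem_union.1 (Finset.mem_coe.1 hx) with hx | hx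
        · exact hBf hx
        · exact (Finset.mem_filter.1 hx).2)
    refine ⟨X ∪ X₀, ⟨B', hb', hB'f, hB'⟩, Finset.subset_union_right, hdS, ?_, ?_, ?_⟩
    · intro x hx hxf
      apply hnX
      refine Set.Subset.trans ?_ (hf.2 X (X ∪ X₀) Finset.subset_union_left)
      exact (hf.1 _).absorb hB (fun y hy hyS => Finset.disjoint_left.1 hdS hy hyS) hx hxf
    · exact fun x hx => hFB' (Finset.mem_union_left _ hx)
    · exact fun x hx hxf => hFB' (Finset.mem_union_right _ (Finset.mem_filter.2 ⟨hx, hxf⟩))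
  choose S nx h1 h2 h3 h4 h5 using hstep
  let B₀ : {B // Ok B} := ⟨{b}, by simp, by simpa using hb, strong_of_hub b (by
    intro x hx
    obtain rfl : x = b := by simpa using hx
    exact ⟨⟨hx, hx, .refl⟩, ⟨hx, hx, .refl⟩⟩)⟩
  let st : ℕ → {B // Ok B} := fun k => nx^[k] B₀
  have hst : ∀ k, st (k + 1) = nx (st k) := fun k => Function.iterate_succ_apply' nx k _
  have hBmono : Monotone fun k => (st k).1 :=
    monotone_nat_of_le_succ fun k => by rw [hst]; exact h4 _
  have hf0 : ∀ k, f (S (st k)) ⊆ f X₀ := fun k => hf.2 _ _ (h1 _)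
  have hSB : ∀ k, ∀ x ∈ S (st k), x ∈ f X₀ → x ∈ (st (k + 1)).1 := by
    intro k x hx hx0
    rw [hst]
    exact h5 _ x hx hx0
  have hanti : Antitone fun k => f (S (st k)) := by
    refine antitone_nat_of_succ_le fun k => hf.sub_of_disj ?_
    intro x hx hxf
    exact h3 (st (k + 1)) x (hSB k x hx (hf0 _ hxf)) hxf
  have hempty : ∀ v, ∃ n, v ∉ f (S (st n)) := by
    intro v
    by_contra hc
    push Not at hc
    have hv0 : v ∈ f X₀ := hf0 0 (hc 0)
    obtain ⟨T, hbT, hvT, hTf, hT⟩ := (hf.1 X₀).strong.exists_finset hb {v} (by simpa using hv0)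
    have hmeet : ∀ n, ∃ t, t ∈ T ∧ t ∈ S (st n) := by
      intro n
      by_contra hcc
      push Not at hcc
      have := (hf.1 (S (st n))).absorb hT (fun y hy hyS => hcc y hy hyS)
        (hvT (Finset.mem_singleton_self v)) (hc n)
      exact h3 (st n) b (st n).2.1 (this hbT)
    choose t htT htS using hmeet
    have hne : ∀ m n, m < n → t m ≠ t n := by
      intro m n hmn he
      have hm : t m ∈ (st n).1 := hBmono (Nat.succ_le_of_lt hmn) (hSB m _ (htS m) (hTf (htT m)))
      exact Finset.disjoint_left.1 (h2 (st n)) hm (he ▸ htS n)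
    have hinj : Function.Injective t := by
      intro m n he
      rcases lt_trichotomy m n with hlt | hlt | hlt
      · exact absurd he (hne _ _ hlt)
      · exact hlt
      · exact absurd he.symm (hne _ _ hlt)
    exact Set.infinite_of_injective_forall_mem hinj (s := (T : Set V)) htT T.finite_toSet
  choose N hN using hempty
  choose p hp using fun n => (hf.1 (S (st n))).nonempty'
  refine ⟨p, fun n => f (S (st n)), ?_, ?_⟩
  · intro n
    exact (hf.1 _).strong _ (hp n) _ (hanti (Nat.le_succ n) (hp (n + 1)))
  · intro X
    refine ⟨X.sup N, fun n hn => hf.sub_of_disj ?_⟩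
    intro x hx hxf
    exact hN x (hanti ((Finset.le_sup (f := N) hx).trans hn) hxf)

theorem IsVertexDirection.exists_ray (hf : IsVertexDirection D f) :
    ∃ R, IsRay D R ∧ ∀ X : Finset V, HasTailIn R (f X) := by
  classical
  obtain ⟨p, W, hpW, hW⟩ : ∃ (p : ℕ → V) (W : ℕ → Set V),
      (∀ n, ReachIn D (W n) (p n) (p (n + 1))) ∧
      ∀ X : Finset V, ∃ N, ∀ n, N ≤ n → W n ⊆ f X := by
    by_cases h : ∀ X : Finset V, ∃ B, GoodBead D f B ∧ Disjoint B X
    · exact segments_of_beads hf h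
    · push Not at h
      exact segments_of_not_beads hf h
  obtain ⟨w, hw, hwW⟩ := exists_lazy_walk p W hpW
  have htail : ∀ X : Finset V, ∃ K, ∀ k, K ≤ k → w k ∈ f X := by
    intro X
    obtain ⟨N, hN⟩ := hW X
    obtain ⟨K, hK⟩ := hwW N
    refine ⟨K, fun k hk => ?_⟩
    obtain ⟨n, hn, hm⟩ := hK k hk
    exact hN n hn hm
  obtain ⟨κ, hκ, hR⟩ := exists_ray_of_lazy w hw (by
    intro v
    obtain ⟨K, hK⟩ := htail {v}
    refine ⟨K, fun k hk he => ?_⟩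
    have := (hf.1 {v}).sub (hK k hk)
    simp [he] at this)
  refine ⟨_, hR, fun X => ?_⟩
  obtain ⟨K, hK⟩ := htail X
  exact ⟨K, fun m hm => hK _ (hm.trans (hκ.id_le m))⟩

end direction

theorem HasTailIn.common {R : ℕ → V} {C C' : Set V} (h : HasTailIn R C) (h' : HasTailIn R C') :
    ∃ x, x ∈ C ∧ x ∈ C' := by
  obtain ⟨n, hn⟩ := h
  obtain ⟨m, hm⟩ := h'
  exact ⟨R (max n m), hn _ (le_max_left _ _), hm _ (le_max_right _ _)⟩

theorem IsSCCIn.eq_of_tail {D : V → V → Prop} {S C C' : Set V} (h : IsSCCIn D S C)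
    (h' : IsSCCIn D S C') {R : ℕ → V} (hR : HasTailIn R C) (hR' : HasTailIn R C') : C = C' := by
  obtain ⟨x, hx, hx'⟩ := hR.common hR'
  exact h.eq_of h' hx hx'

theorem IsEnd.exists_dir {D : V → V → Prop} {Ω : Set (ℕ → V)} (h : IsEnd D Ω) :
    ∃ f, IsVertexDirection D f ∧ ∀ R, R ∈ Ω ↔ (IsRay D R ∧ ∀ X, HasTailIn R (f X)) := by
  obtain ⟨R, hR, rfl⟩ := h
  choose f hf hRf using hR.2
  refine ⟨f, ⟨hf, ?_⟩, ?_⟩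
  · intro X Y hXY
    obtain ⟨x, hx, hx'⟩ := (hRf X).common (hRf Y)
    exact (hf X).absorb (hf Y).strong (fun y hy hyX => (hf Y).sub hy (hXY hyX)) hx' hx
  · intro R'
    constructor
    · rintro ⟨hs, he⟩
      refine ⟨hs.1, fun X => ?_⟩
      obtain ⟨C, hC, h1, h2⟩ := he X
      rwa [(hf X).eq_of_tail hC (hRf X) h1]
    · rintro ⟨hr, ht⟩
      exact ⟨⟨hr, fun X => ⟨f X, hf X, ht X⟩⟩, fun X => ⟨f X, hf X, hRf X, ht X⟩⟩

/-- The map `ω ↦ f_ω` is a bijection between the ends and the vertex-directions of an infinite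
digraph. -/
theorem ends_equiv_vertex_directions (D : V → V → Prop) [Infinite V] :
    ∃ F : {Ω : Set (ℕ → V) // IsEnd D Ω} → {f : Finset V → Set V // IsVertexDirection D f},
      Function.Bijective F ∧
      ∀ (Ω : {Ω : Set (ℕ → V) // IsEnd D Ω}), ∀ R ∈ Ω.1, ∀ X : Finset V,
        HasTailIn R ((F Ω).1 X) := by
  classical
  choose G hG1 hG2 using fun Ω : {Ω : Set (ℕ → V) // IsEnd D Ω} => Ω.2.exists_dir
  refine ⟨fun Ω => ⟨G Ω, hG1 Ω⟩, ⟨?_, ?_⟩, fun Ω R hR X => ((hG2 Ω R).1 hR).2 X⟩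
  · intro Ω Ω' h
    have h : G Ω = G Ω' := congrArg Subtype.val h
    apply Subtype.ext
    ext R
    rw [hG2 Ω, hG2 Ω', h]
  · rintro ⟨f, hf⟩
    obtain ⟨R, hR, ht⟩ := hf.exists_ray
    have hs : Solid D R := ⟨hR, fun X => ⟨f X, hf.1 X, ht X⟩⟩
    have hm : R ∈ {R' | Solid D R' ∧ EndEquiv D R R'} :=
      ⟨hs, fun X => ⟨f X, hf.1 X, ht X, ht X⟩⟩
    refine ⟨⟨{R' | Solid D R' ∧ EndEquiv D R R'}, R, hs, rfl⟩, ?_⟩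
    apply Subtype.ext
    funext X
    exact ((hG1 _).1 X).eq_of_tail (hf.1 X) (((hG2 _ R).1 hm).2 X) (ht X)
end

section
/- For a digraph D, a vertex v, and an end ω, the following are equivalent: (i) D has a limit edge from v to ω; (ii) there is a necklace N representing ω such that v sends an edge to every bead of N. -/
variable {V : Type*}

theorem scc_sub (D : V → V → Prop) {S S' C C' : Set V} (hS : S' ⊆ S)
    (hC : IsSCCIn D S C) (hC' : IsSCCIn D S' C') {z : V} (hz : z ∈ C) (hz' : z ∈ C') :
    C' ⊆ C := by
  obtain ⟨a, ha, rfl⟩ := hC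
  obtain ⟨a', ha', rfl⟩ := hC'
  have mono : ∀ {x y}, ReachIn D S' x y → ReachIn D S x y := fun h =>
    ⟨hS h.1, hS h.2.1, Relation.ReflTransGen.mono (fun _ _ h => ⟨hS h.1, h.2⟩) _ _ h.2.2⟩
  have tr : ∀ {x y w}, ReachIn D S x y → ReachIn D S y w → ReachIn D S x w := fun h h' =>
    ⟨h.1, h'.2.1, h.2.2.trans h'.2.2⟩
  intro x hx
  exact ⟨tr hz.1 (tr (mono hz'.2) (mono hx.1)), tr (mono hx.2) (tr (mono hz'.1) hz.2)⟩

theorem scc_strong (D : V → V → Prop) {S C : Set V} (hC : IsSCCIn D S C) :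
    ∀ a ∈ C, ∀ b ∈ C, ReachIn D C a b := by
  obtain ⟨a, ha, rfl⟩ := hC
  intro x hx y hy
  refine ⟨hx, hy, ?_⟩
  have hxy := hx.2.2.2.trans hy.1.2.2
  have hxS := hx.1.2.1
  clear ha
  revert hx
  induction hxy using Relation.ReflTransGen.head_induction_on with
  | refl => intro _; exact .refl
  | head h h' ih =>
    rename_i p q
    intro hp
    have hq : q ∈ {b | ReachIn D S a b ∧ ReachIn D S b a} :=
      ⟨⟨hp.1.1, h.1, hp.1.2.2.tail h⟩, ⟨h.1, hp.1.1, h'.trans hy.2.2.2⟩⟩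
    exact Relation.ReflTransGen.head ⟨hq, h.2⟩ (ih h.1 hq)

/-- Walks inside `S` from `A` to `B`. -/
def WalkL (D : V → V → Prop) (S A B : Set V) (l : List V) : Prop :=
  l.IsChain D ∧ (∀ x ∈ l, x ∈ S) ∧ (∃ a ∈ A, l.head? = some a) ∧
    (∃ b ∈ B, l.getLast? = some b)

theorem walkL_of_reach (D : V → V → Prop) {S : Set V} {a b : V} (h : ReachIn D S a b) :
    ∃ l, WalkL D S {a} {b} l := by
  obtain ⟨ha, hb, h⟩ := h
  induction h using Relation.ReflTransGen.head_induction_on with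
  | refl => exact ⟨[b], by simp [WalkL, hb]⟩
  | head h h' ih =>
    rename_i p q
    obtain ⟨l, h1, h2, ⟨_, rfl, h3⟩, ⟨_, rfl, h4⟩⟩ := ih h.1
    refine ⟨p :: l, ?_, ?_, ⟨p, rfl, rfl⟩, ⟨_, rfl, ?_⟩⟩
    · cases l with
      | nil => simp at h3
      | cons x l => simp at h3; subst h3; simp [h.2, h1]
    · simp [ha]; exact h2
    · cases l with
      | nil => simp at h3
      | cons x l => simpa using h4

theorem reach_prefix (D : V → V → Prop) {T : Set V} (u w : List V) (x a : V)
    (hc : (u ++ x :: w).IsChain D) (hh : (u ++ x :: w).head? = some a)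
    (hu : ∀ y ∈ u, y ∈ T) (hx : x ∈ T) : ReachIn D T a x := by
  induction u generalizing a with
  | nil => simp at hh; subst hh; exact ⟨hx, hx, .refl⟩
  | cons c u ih =>
    simp at hh; subst hh
    have hc' : (u ++ x :: w).IsChain D := hc.tail
    obtain ⟨d, hd⟩ : ∃ d, (u ++ x :: w).head? = some d := by cases u <;> simp
    have := ih d hc' hd (fun y hy => hu y (by simp [hy]))
    refine ⟨hu _ (by simp), hx, .head ⟨this.1, ?_⟩ this.2.2⟩
    cases u <;> simp_all

theorem reach_suffix (D : V → V → Prop) {T : Set V} (u w : List V) (x b : V)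
    (hc : (u ++ x :: w).IsChain D) (hh : (u ++ x :: w).getLast? = some b)
    (hu : ∀ y ∈ w, y ∈ T) (hx : x ∈ T) : ReachIn D T x b := by
  have hc' : (x :: w).IsChain D := (List.isChain_append.1 hc).2.1
  have hh' : (x :: w).getLast? = some b := by simpa using hh
  clear hc hh
  induction w generalizing x with
  | nil => simp at hh'; subst hh'; exact ⟨hx, hx, .refl⟩
  | cons c w ih =>
    have := ih c (fun y hy => hu y (by simp [hy])) (hu c (by simp)) hc'.tail (by simpa using hh')
    exact ⟨hx, this.2.1, .head ⟨hu c (by simp), by simp at hc'; exact hc'.1⟩ this.2.2⟩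

theorem walkL_suffix (D : V → V → Prop) {S A B A' : Set V} {u w : List V} {x : V}
    (h : WalkL D S A B (u ++ x :: w)) (hx : x ∈ A') : WalkL D S A' B (x :: w) := by
  obtain ⟨h1, h2, h3, b, hb, h4⟩ := h
  exact ⟨(List.isChain_append.1 h1).2.1, fun y hy => h2 y (by simp at hy ⊢; tauto),
    ⟨x, hx, rfl⟩, b, hb, by simpa using h4⟩

theorem walkL_prefix (D : V → V → Prop) {S A B B' : Set V} {u w : List V} {x : V}
    (h : WalkL D S A B (u ++ x :: w)) (hx : x ∈ B') : WalkL D S A B' (u ++ [x]) := by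
  obtain ⟨h1, h2, ⟨a, ha, h3⟩, h4⟩ := h
  refine ⟨?_, fun y hy => h2 y (by simp at hy ⊢; tauto), ⟨a, ha, ?_⟩, x, hx, by simp⟩
  · have : u ++ x :: w = (u ++ [x]) ++ w := by simp
    rw [this] at h1
    exact (List.isChain_append.1 h1).1
  · cases u <;> simpa using h3

theorem walkL_min (D : V → V → Prop) {S A B : Set V} {l : List V} (h : WalkL D S A B l)
    (hmin : ∀ l', WalkL D S A B l' → l.length ≤ l'.length) :
    IsPathList D l ∧ (∀ u x w, l = u ++ x :: w → u ≠ [] → x ∉ A) ∧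
      (∀ u x w, l = u ++ x :: w → w ≠ [] → x ∉ B) := by
  refine ⟨⟨?_, ?_, h.1⟩, ?_, ?_⟩
  · rintro rfl; obtain ⟨_, _, ⟨a, _, h⟩, _⟩ := h; simp at h
  · by_contra hnd
    obtain ⟨x, hx⟩ := List.exists_duplicate_iff_not_nodup.2 hnd
    have : ∃ u w t, l = u ++ x :: (w ++ x :: t) := by
      clear hnd hmin h
      induction hx with
      | cons_mem hm =>
        obtain ⟨s, t, rfl⟩ := List.append_of_mem hm
        exact ⟨[], s, t, rfl⟩
      | cons_duplicate _ ih =>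
        obtain ⟨u, w, t, rfl⟩ := ih
        exact ⟨_ :: u, w, t, rfl⟩
    obtain ⟨u, w, t, rfl⟩ := this
    have hp := walkL_prefix D (B' := {x}) h rfl
    have h' : WalkL D S A B ((u ++ x :: w) ++ x :: t) := by simpa using h
    have hs := walkL_suffix D (A' := {x}) h' rfl
    have : WalkL D S A B (u ++ x :: t) := by
      refine ⟨?_, ?_, ?_, ?_⟩
      · have h1 := hp.1
        have h2 := hs.1
        rw [List.isChain_append] at h1 ⊢
        refine ⟨h1.1, h2, ?_⟩
        simpa using h1.2.2
      · intro y hy; apply h.2.1; simp at hy ⊢; tauto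
      · obtain ⟨a, ha, h3⟩ := h.2.2.1
        exact ⟨a, ha, by cases u <;> simpa using h3⟩
      · obtain ⟨b, hb, h3⟩ := hs.2.2.2
        exact ⟨b, hb, by simpa using h3⟩
    have := hmin _ this
    simp at this
    omega
  · rintro u x w rfl hu hx
    have h1 := hmin _ (walkL_suffix D h hx)
    have h2 := List.length_pos_of_ne_nil hu
    simp only [List.length_append, List.length_cons, List.length_nil] at h1
    omega
  · rintro u x w rfl hu hx
    have h1 := hmin _ (walkL_prefix D h hx)
    have h2 := List.length_pos_of_ne_nil hu
    simp only [List.length_append, List.length_cons, List.length_nil] at h1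
    omega

theorem exists_min_len {α : Type*} (P : α → Prop) (f : α → ℕ) (h : ∃ a, P a) :
    ∃ a, P a ∧ ∀ b, P b → f a ≤ f b := by
  obtain ⟨a, ha, hm⟩ := (measure f).wf.has_min {a | P a} h
  exact ⟨a, ha, fun b hb => not_lt.1 (hm b hb)⟩

theorem reach_mono (D : V → V → Prop) {S T : Set V} (h : S ⊆ T) {a b : V}
    (hr : ReachIn D S a b) : ReachIn D T a b :=
  ⟨h hr.1, h hr.2.1, Relation.ReflTransGen.mono (fun _ _ h' => ⟨h h'.1, h'.2⟩) _ _ hr.2.2⟩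

theorem reach_trans (D : V → V → Prop) {S : Set V} {a b c : V}
    (h : ReachIn D S a b) (h' : ReachIn D S b c) : ReachIn D S a c :=
  ⟨h.1, h'.2.1, h.2.2.trans h'.2.2⟩

theorem exists_finite_strong (D : V → V → Prop) {C F : Set V}
    (hC : ∀ a ∈ C, ∀ b ∈ C, ReachIn D C a b) (hF : F.Finite) (hFC : F ⊆ C) {a₀ : V}
    (ha₀ : a₀ ∈ F) :
    ∃ B : Set V, B.Finite ∧ F ⊆ B ∧ B ⊆ C ∧ ∀ a ∈ B, ∀ b ∈ B, ReachIn D B a b := by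
  have h1 : ∀ x, ∃ l, x ∈ F → WalkL D C {a₀} {x} l := fun x => by
    by_cases hx : x ∈ F
    · obtain ⟨l, hl⟩ := walkL_of_reach D (hC a₀ (hFC ha₀) x (hFC hx))
      exact ⟨l, fun _ => hl⟩
    · exact ⟨[], fun h => (hx h).elim⟩
  have h2 : ∀ x, ∃ l, x ∈ F → WalkL D C {x} {a₀} l := fun x => by
    by_cases hx : x ∈ F
    · obtain ⟨l, hl⟩ := walkL_of_reach D (hC x (hFC hx) a₀ (hFC ha₀))
      exact ⟨l, fun _ => hl⟩
    · exact ⟨[], fun h => (hx h).elim⟩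
  choose p hp using h1
  choose q hq using h2
  let B : Set V := ⋃ x ∈ F, ({y | y ∈ p x} ∪ {y | y ∈ q x})
  have hpB : ∀ x ∈ F, ∀ y ∈ p x, y ∈ B := fun x hx y hy =>
    Set.mem_biUnion hx (Or.inl hy)
  have hqB : ∀ x ∈ F, ∀ y ∈ q x, y ∈ B := fun x hx y hy =>
    Set.mem_biUnion hx (Or.inr hy)
  have hFp : ∀ x ∈ F, x ∈ p x := fun x hx => by
    obtain ⟨_, _, _, ⟨_, rfl, h⟩⟩ := hp x hx
    exact List.mem_of_getLast? h
  have key : ∀ y ∈ B, ReachIn D B a₀ y ∧ ReachIn D B y a₀ := by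
    intro y hy
    have ra : ∀ x ∈ F, ∀ y ∈ p x, ReachIn D B a₀ y ∧ ReachIn D B y x := by
      intro x hx y hy
      obtain ⟨u, w, e⟩ := List.append_of_mem hy
      have hm := hpB x hx
      obtain ⟨c, _, ⟨_, rfl, ha⟩, ⟨_, rfl, hb⟩⟩ := hp x hx
      rw [e] at c ha hb hm
      exact ⟨reach_prefix D u w y _ c ha (fun z hz => hm z (by simp [hz])) (hm y (by simp)),
        reach_suffix D u w y _ c hb (fun z hz => hm z (by simp [hz])) (hm y (by simp))⟩
    have rb : ∀ x ∈ F, ∀ y ∈ q x, ReachIn D B x y ∧ ReachIn D B y a₀ := by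
      intro x hx y hy
      obtain ⟨u, w, e⟩ := List.append_of_mem hy
      have hm := hqB x hx
      obtain ⟨c, _, ⟨_, rfl, ha⟩, ⟨_, rfl, hb⟩⟩ := hq x hx
      rw [e] at c ha hb hm
      exact ⟨reach_prefix D u w y _ c ha (fun z hz => hm z (by simp [hz])) (hm y (by simp)),
        reach_suffix D u w y _ c hb (fun z hz => hm z (by simp [hz])) (hm y (by simp))⟩
    obtain ⟨x, hx, hy⟩ := Set.mem_iUnion₂.1 hy
    have hxq : x ∈ q x := by
      obtain ⟨_, _, ⟨_, rfl, h⟩, _⟩ := hq x hx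
      exact List.mem_of_head? h
    rcases hy with hy | hy
    · exact ⟨(ra x hx y hy).1, reach_trans D (ra x hx y hy).2 (rb x hx x hxq).2⟩
    · exact ⟨reach_trans D (ra x hx x (hFp x hx)).1 (rb x hx y hy).1, (rb x hx y hy).2⟩
  refine ⟨B, ?_, fun x hx => hpB x hx x (hFp x hx), ?_, fun a ha b hb =>
    reach_trans D (key a ha).2 (key b hb).1⟩
  · exact hF.biUnion fun x _ => (List.finite_toSet _).union (List.finite_toSet _)
  · intro y hy
    obtain ⟨x, hx, hy⟩ := Set.mem_iUnion₂.1 hy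
    rcases hy with hy | hy
    · exact (hp x hx).2.1 y hy
    · exact (hq x hx).2.1 y hy

theorem mem_inner {l : List V} {x : V} (h : x ∈ l.tail.dropLast) :
    ∃ u w, l = u ++ x :: w ∧ u ≠ [] ∧ w ≠ [] := by
  cases l with
  | nil => simp at h
  | cons a l =>
    simp only [List.tail_cons] at h
    obtain ⟨u, w, e⟩ := List.append_of_mem h
    have hl : l ≠ [] := by rintro rfl; simp at h
    refine ⟨a :: u, w ++ [l.getLast hl], ?_, by simp, by simp⟩
    conv_lhs => rw [← List.dropLast_append_getLast hl, e]
    simp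

/-- Enlarging a finite strong set and linking it to `C'` in both directions. -/
theorem link_step (D : V → V → Prop) {C C' B : Set V}
    (hC : ∀ a ∈ C, ∀ b ∈ C, ReachIn D C a b) (hC' : C' ⊆ C) (hne : C'.Nonempty)
    (hB : B.Finite) (hBne : B.Nonempty) (hBC : B ⊆ C \ C')
    (hBs : ∀ a ∈ B, ∀ b ∈ B, ReachIn D B a b) :
    ∃ (B' : Set V) (P Q : List V), B'.Finite ∧ B ⊆ B' ∧ B' ⊆ C \ C' ∧
      (∀ a ∈ B', ∀ b ∈ B', ReachIn D B' a b) ∧ IsPathList D P ∧ IsPathList D Q ∧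
      (∃ a ∈ B', P.head? = some a) ∧ (∃ b ∈ C', P.getLast? = some b) ∧
      (∃ a ∈ C', Q.head? = some a) ∧ (∃ b ∈ B', Q.getLast? = some b) ∧
      (∀ x ∈ P.tail.dropLast, x ∈ C \ C' ∧ x ∉ B') ∧
      (∀ x ∈ Q.tail.dropLast, x ∈ C \ C' ∧ x ∉ B') ∧
      (∀ x ∈ P.tail.dropLast, x ∉ Q.tail.dropLast) := by
  obtain ⟨b₀, hb₀⟩ := hBne
  obtain ⟨c₀, hc₀⟩ := hne
  have widen : ∀ {A A' B B' : Set V} {l}, A ⊆ A' → B ⊆ B' → WalkL D C A B l →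
      WalkL D C A' B' l := by
    rintro A A' B B' l h h' ⟨h1, h2, ⟨a, ha, h3⟩, b, hb, h4⟩
    exact ⟨h1, h2, ⟨a, h ha, h3⟩, b, h' hb, h4⟩
  obtain ⟨⟨B', P⟩, ⟨hfin, hsub, hBC', hstr, hP⟩, hmin⟩ := exists_min_len
    (fun p : Set V × List V => p.1.Finite ∧ B ⊆ p.1 ∧ p.1 ⊆ C \ C' ∧
      (∀ a ∈ p.1, ∀ b ∈ p.1, ReachIn D p.1 a b) ∧ WalkL D C p.1 C' p.2)
    (fun p => p.2.length) (by
      obtain ⟨l, hl⟩ := walkL_of_reach D (hC b₀ (hBC hb₀).1 c₀ (hC' hc₀))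
      exact ⟨⟨B, l⟩, hB, subset_rfl, hBC, hBs, widen (by simpa) (by simpa) hl⟩)
  dsimp only at *
  obtain ⟨Q, hQ, hQmin⟩ := exists_min_len (fun l => WalkL D C C' B' l) List.length (by
      obtain ⟨l, hl⟩ := walkL_of_reach D (hC c₀ (hC' hc₀) b₀ (hBC hb₀).1)
      exact ⟨l, widen (by simpa) (by simpa using hsub hb₀) hl⟩)
  obtain ⟨p1, p2, p3⟩ := walkL_min D hP
    (fun l' h => hmin ⟨B', l'⟩ ⟨hfin, hsub, hBC', hstr, h⟩)
  obtain ⟨q1, q2, q3⟩ := walkL_min D hQ hQmin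
  refine ⟨B', P, Q, hfin, hsub, hBC', hstr, p1, q1, hP.2.2.1, hP.2.2.2, hQ.2.2.1, hQ.2.2.2,
    ?_, ?_, ?_⟩
  · intro x hx
    obtain ⟨u, w, e, hu, hw⟩ := mem_inner hx
    exact ⟨⟨hP.2.1 x (by simp [e]), p3 u x w e hw⟩, p2 u x w e hu⟩
  · intro x hx
    obtain ⟨u, w, e, hu, hw⟩ := mem_inner hx
    exact ⟨⟨hQ.2.1 x (by simp [e]), q2 u x w e hu⟩, q3 u x w e hw⟩
  · intro z hz hz'
    obtain ⟨u, w, e, hu, hw⟩ := mem_inner hz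
    obtain ⟨s, t, e', hs, ht⟩ := mem_inner hz'
    have hzC' := p3 u z w e hw
    obtain ⟨a, ha, hPa⟩ := hP.2.2.1
    obtain ⟨b, hb, hQb⟩ := hQ.2.2.2
    let B'' : Set V := B' ∪ ({y | y ∈ u ++ [z]} ∪ {y | y ∈ t})
    have hB' : B' ⊆ B'' := fun x hx => Or.inl hx
    have huB : ∀ y ∈ u, y ∈ B'' := fun y hy => Or.inr (Or.inl (by simp [hy]))
    have hzB : z ∈ B'' := Or.inr (Or.inl (by simp))
    have htB : ∀ y ∈ t, y ∈ B'' := fun y hy => Or.inr (Or.inr hy)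
    have hPc := hP.1
    have hQc := hQ.1
    have haz : ReachIn D B'' a z := reach_prefix D u w z a (e ▸ hPc) (e ▸ hPa) huB hzB
    have hzb : ReachIn D B'' z b := reach_suffix D s t z b (e' ▸ hQc) (e' ▸ hQb) htB hzB
    have hba : ReachIn D B'' b a := reach_mono D hB' (hstr b hb a ha)
    have key : ∀ y ∈ B'', ReachIn D B'' a y ∧ ReachIn D B'' y a := by
      rintro y (hy | hy | hy)
      · exact ⟨reach_mono D hB' (hstr a ha y hy), reach_mono D hB' (hstr y hy a ha)⟩
      · have hy : y ∈ u ++ [z] := hy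
        have hy' : y ∈ u ∨ y = z := by simpa using hy
        rcases hy' with hy | rfl
        · obtain ⟨u1, u2, rfl⟩ := List.append_of_mem hy
          have e2 : P = u1 ++ y :: (u2 ++ z :: w) := by rw [e]; simp
          have e3 : P = (u1 ++ y :: (u2 ++ [z])) ++ w := by rw [e]; simp
          have c3 := (List.isChain_append.1 (e3 ▸ hPc)).1
          refine ⟨reach_prefix D u1 _ y a (e2 ▸ hPc) (e2 ▸ hPa)
            (fun x hx => huB x (by simp [hx])) (huB y (by simp)), ?_⟩
          refine reach_trans D (reach_suffix D u1 (u2 ++ [z]) y z c3 (by simp [List.getLast?_cons]) ?_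
            (huB y (by simp))) (reach_trans D hzb hba)
          intro x hx
          have : x ∈ u2 ∨ x = z := by simpa using hx
          rcases this with h | rfl
          · exact huB x (by simp [h])
          · exact hzB
        · exact ⟨haz, reach_trans D hzb hba⟩
      · have hy : y ∈ t := hy
        obtain ⟨t1, t2, rfl⟩ := List.append_of_mem hy
        have e2 : Q = (s ++ z :: t1) ++ y :: t2 := by rw [e']; simp
        have c3 := (List.isChain_append.1 (e' ▸ hQc)).2.1
        refine ⟨reach_trans D haz ?_, reach_trans D
          (reach_suffix D (s ++ z :: t1) t2 y b (e2 ▸ hQc) (e2 ▸ hQb)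
          (fun x hx => htB x (by simp [hx])) (htB y (by simp))) hba⟩
        refine reach_prefix D (z :: t1) t2 y z c3 (by simp) ?_ (htB y (by simp))
        intro x hx
        have : x = z ∨ x ∈ t1 := by simpa using hx
        rcases this with rfl | h
        · exact hzB
        · exact htB x (by simp [h])
    have := hmin ⟨B'', z :: w⟩ ⟨?_, hsub.trans hB', ?_, fun x hx y hy =>
      reach_trans D (key x hx).2 (key y hy).1, walkL_suffix D (e ▸ hP) hzB⟩
    · have hl := List.length_pos_of_ne_nil hu
      rw [e] at this
      simp only [List.length_append, List.length_cons] at this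
      omega
    · exact hfin.union ((List.finite_toSet _).union (List.finite_toSet _))
    · rintro y (hy | hy | hy)
      · exact hBC' hy
      · have hy : y ∈ u ++ [z] := hy
        have hy' : y ∈ u ∨ y = z := by simpa using hy
        rcases hy' with hy | rfl
        · obtain ⟨u1, u2, rfl⟩ := List.append_of_mem hy
          have e2 : P = u1 ++ y :: (u2 ++ z :: w) := by rw [e]; simp
          exact ⟨hP.2.1 y (by simp [e]), p3 _ _ _ e2 (by simp)⟩
        · exact ⟨hP.2.1 y (by simp [e]), hzC'⟩
      · have hy : y ∈ t := hy
        obtain ⟨t1, t2, rfl⟩ := List.append_of_mem hy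
        have e2 : Q = (s ++ z :: t1) ++ y :: t2 := by rw [e']; simp
        exact ⟨hQ.2.1 y (by simp [e2]), q2 _ _ _ e2 (by simp)⟩

/-- All data produced in one step of the construction. -/
structure StepSpec (D : V → V → Prop) (v : V) (R : ℕ → V) (C C' F F' : Set V) (n : ℕ)
    (B : Set V) (P Q : List V) : Prop where
  fin : B.Finite
  sub : B ⊆ C \ C'
  strong : ∀ a ∈ B, ∀ b ∈ B, ReachIn D B a b
  FB : F ⊆ B
  ray : ∃ k, n ≤ k ∧ R k ∈ B
  edge : ∃ w ∈ B, D v w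
  pathP : IsPathList D P
  pathQ : IsPathList D Q
  headP : ∀ a, P.head? = some a → a ∈ B
  lastP : ∀ a, P.getLast? = some a → a ∈ F'
  headQ : ∀ a, Q.head? = some a → a ∈ F'
  lastQ : ∀ a, Q.getLast? = some a → a ∈ B
  innerP : ∀ x ∈ P.tail.dropLast, x ∈ C \ C' ∧ x ∉ B
  innerQ : ∀ x ∈ Q.tail.dropLast, x ∈ C \ C' ∧ x ∉ B
  disj : ∀ x ∈ P.tail.dropLast, x ∉ Q.tail.dropLast
  anti : C' ⊆ C

theorem limit_edge_forward (D : V → V → Prop) (v : V) (Rω : ℕ → V)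
    (hω : Solid D Rω) (hL : LimitEdgeVE D v Rω) :
      ∃ N : Necklace D, NecklaceRepresents N Rω ∧ ∀ n, ∃ b ∈ N.bead n, D v b := by
  classical
  choose K hK hKt using hω.2
  have hanti : ∀ X Y : Finset V, X ⊆ Y → K Y ⊆ K X := by
    intro X Y h
    obtain ⟨n, hn⟩ := hKt X
    obtain ⟨m, hm⟩ := hKt Y
    exact scc_sub D (by simpa using h) (hK X) (hK Y) (hn _ (le_max_left n m))
      (hm _ (le_max_right n m))
  have hdisj : ∀ X : Finset V, ∀ x ∈ K X, x ∉ X := by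
    intro X x hx
    obtain ⟨a, ha, e⟩ := hK X
    rw [e] at hx
    exact hx.1.2.1
  let St := {p : Finset V × Set V // v ∈ p.1 ∧ p.2.Finite ∧ p.2 ⊆ K p.1}
  have step : ∀ (n : ℕ) (s : St), ∃ (s' : St) (B : Set V) (P Q : List V),
      StepSpec D v Rω (K s.1.1) (K s'.1.1) s.1.2 s'.1.2 n B P Q := by
    rintro n ⟨⟨X, F⟩, hvX, hF, hFK⟩
    dsimp only at *
    obtain ⟨w, hw, hvw⟩ := hL X (K X) (hK X) (hKt X) (fun h => hdisj X v h hvX)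
    obtain ⟨m, hm⟩ := hKt X
    obtain ⟨B₀, hB₀, hFB₀, hB₀C, hB₀s⟩ := exists_finite_strong D
      (F := insert w (insert (Rω (max n m)) F)) (scc_strong D (hK X))
      ((hF.insert _).insert _)
      (Set.insert_subset hw (Set.insert_subset (hm _ (le_max_right _ _)) hFK))
      (Set.mem_insert _ _)
    let X' := X ∪ hB₀.toFinset
    have hXX : X ⊆ X' := Finset.subset_union_left
    obtain ⟨B, P, Q, h1, h2, h3, h4, h5, h6, ⟨a, ha, ha'⟩, ⟨b, hb, hb'⟩, ⟨c, hc, hc'⟩,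
      ⟨d, hd, hd'⟩, h7, h8, h9⟩ := link_step D (C := K X) (C' := K X') (B := B₀)
      (scc_strong D (hK X)) (hanti _ _ hXX)
      (by obtain ⟨n, hn⟩ := hKt X'; exact ⟨_, hn n le_rfl⟩) hB₀
      ⟨w, hFB₀ (Set.mem_insert _ _)⟩
      (fun x hx => ⟨hB₀C hx, fun h => hdisj X' x h (by simp [X', hx])⟩) hB₀s
    refine ⟨⟨⟨X', {b, c}⟩, hXX hvX, by simp, ?_⟩, B, P, Q, ?_⟩
    · rintro x (rfl | rfl) <;> assumption
    · refine ⟨h1, h3, h4, ?_, ⟨max n m, le_max_left _ _, h2 (hFB₀ (by simp))⟩,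
        ⟨w, h2 (hFB₀ (by simp)), hvw⟩, h5, h6, ?_, ?_, ?_, ?_, h7, h8, h9, hanti _ _ hXX⟩
      · intro x hx; exact h2 (hFB₀ (by simp [hx]))
      · intro x hx; rw [ha'] at hx; cases hx; exact ha
      · intro x hx; rw [hb'] at hx; cases hx; simp
      · intro x hx; rw [hc'] at hx; cases hx; simp
      · intro x hx; rw [hd'] at hx; cases hx; exact hd
  choose nxt Bf Pf Qf hspec using step
  let s : ℕ → St := fun n => Nat.rec ⟨⟨{v}, ∅⟩, by simp⟩ (fun n t => nxt n t) n
  have hs : ∀ n, StepSpec D v Rω (K (s n).1.1) (K (s (n+1)).1.1) (s n).1.2 (s (n+1)).1.2 n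
      (Bf n (s n)) (Pf n (s n)) (Qf n (s n)) := fun n => hspec n (s n)
  generalize hCdef : (fun n => K (s n).1.1) = C at *
  generalize hFdef : (fun n => (s n).1.2) = F at *
  generalize hBdef : (fun n => Bf n (s n)) = B at *
  generalize hPdef : (fun n => Pf n (s n)) = P at *
  generalize hQdef : (fun n => Qf n (s n)) = Q at *
  have hs' : ∀ n, StepSpec D v Rω (C n) (C (n+1)) (F n) (F (n+1)) n (B n) (P n) (Q n) := by
    intro n; have := hs n; simpa [← hCdef, ← hFdef, ← hBdef, ← hPdef, ← hQdef] using this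
  clear hs
  have hCanti : Antitone C := antitone_nat_of_succ_le fun n => (hs' n).anti
  have hT : ∀ m n x, x ∈ C m \ C (m+1) → x ∈ C n \ C (n+1) → m = n := by
    intro m n x hm hn
    rcases lt_trichotomy m n with h | h | h
    · exact (hm.2 (hCanti h hn.1)).elim
    · exact h
    · exact (hn.2 (hCanti h hm.1)).elim
  refine ⟨{
    bead := B
    fwd := P
    bwd := Q
    bead_fin := fun n => (hs' n).fin
    bead_nonempty := fun n => by obtain ⟨k, _, h⟩ := (hs' n).ray; exact ⟨_, h⟩
    bead_disj := fun m n hmn => Set.disjoint_left.2 fun x hx hx' =>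
      hmn (hT m n x ((hs' m).sub hx) ((hs' n).sub hx'))
    bead_strong := fun n => (hs' n).strong
    fwd_path := fun n => (hs' n).pathP
    bwd_path := fun n => (hs' n).pathQ
    fwd_head := fun n => (hs' n).headP
    fwd_last := fun n a h => (hs' (n+1)).FB ((hs' n).lastP a h)
    bwd_head := fun n a h => (hs' (n+1)).FB ((hs' n).headQ a h)
    bwd_last := fun n => (hs' n).lastQ
    fwd_inner := fun n x hx m hm => by
      have h := (hs' n).innerP x hx
      obtain rfl := hT n m x h.1 ((hs' m).sub hm)
      exact h.2 hm
    bwd_inner := fun n x hx m hm => by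
      have h := (hs' n).innerQ x hx
      obtain rfl := hT n m x h.1 ((hs' m).sub hm)
      exact h.2 hm
    fwd_fwd_disj := fun m n hmn x hx hx' =>
      hmn (hT m n x ((hs' m).innerP x hx).1 ((hs' n).innerP x hx').1)
    bwd_bwd_disj := fun m n hmn x hx hx' =>
      hmn (hT m n x ((hs' m).innerQ x hx).1 ((hs' n).innerQ x hx').1)
    fwd_bwd_disj := fun m n x hx hx' => by
      obtain rfl := hT m n x ((hs' m).innerP x hx).1 ((hs' n).innerQ x hx').1
      exact (hs' m).disj x hx hx' }, ?_, fun n => (hs' n).edge⟩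
  intro X
  refine ⟨K X, hK X, hKt X, ?_⟩
  obtain ⟨m, hm⟩ := hKt X
  have : ∃ n₀, ∀ n, n₀ ≤ n → ∀ x ∈ X, x ∉ B n := by
    have hx : ∀ x : V, ∃ n₀, ∀ n, n₀ ≤ n → x ∉ B n := by
      intro x
      by_cases h : ∃ k, x ∈ B k
      · obtain ⟨k, hk⟩ := h
        refine ⟨k + 1, fun n hn hx => ?_⟩
        have := hT k n x ((hs' k).sub hk) ((hs' n).sub hx)
        omega
      · push Not at h
        exact ⟨0, fun n _ => h n⟩
    choose f hf using hx
    exact ⟨X.sup f, fun n hn x hx => hf x n ((Finset.le_sup hx).trans hn)⟩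
  obtain ⟨n₀, hn₀⟩ := this
  refine ⟨max n₀ m, fun n hn y hy => ?_⟩
  obtain ⟨k, hk, hkB⟩ := (hs' n).ray
  have hsub : B n ⊆ ((X : Set V))ᶜ := fun x hx hxX =>
    hn₀ n ((le_max_left _ _).trans hn) x hxX hx
  have hkK : Rω k ∈ K X := hm k (((le_max_right _ _).trans hn).trans hk)
  obtain ⟨a, ha, e⟩ := hK X
  rw [e] at hkK ⊢
  have r1 := reach_mono D hsub ((hs' n).strong _ hkB _ hy)
  have r2 := reach_mono D hsub ((hs' n).strong _ hy _ hkB)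
  exact ⟨reach_trans D hkK.1 r1, reach_trans D r2 hkK.2⟩

/-- `D` has a limit edge from a vertex `v` to an end iff there is a necklace representing the
end each of whose beads receives an edge from `v`. -/
theorem limit_edge_vertex_iff_necklace (D : V → V → Prop) (v : V) (Rω : ℕ → V)
    (hω : Solid D Rω) :
    LimitEdgeVE D v Rω ↔
      ∃ N : Necklace D, NecklaceRepresents N Rω ∧ ∀ n, ∃ b ∈ N.bead n, D v b := by
  refine ⟨limit_edge_forward D v Rω hω, ?_⟩
  rintro ⟨N, hN, hv⟩ X C hC ⟨n, hn⟩ _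
  obtain ⟨C', hC', ⟨m, hm⟩, n₀, h⟩ := hN X
  obtain ⟨b, hb, hvb⟩ := hv n₀
  exact ⟨b, scc_sub D subset_rfl hC hC' (hn _ (le_max_left n m)) (hm _ (le_max_right n m))
    (h n₀ le_rfl hb), hvb⟩
end
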